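/- arXiv:1304.6873 — 6 statements merged into one kernel-verified Lean document; each statement's English description precedes it below -/
import Mathlib

section
/- Let f : ℝ → ℝ be five times continuously differentiable on an open interval I, and let α ∈ I be a simple root of f (i.e. f(α) = 0 and f'(α) ≠ 0). Then there exist δ > 0 and K > 0 such that for every x with 0 < |x − α| < δ, the quantities y = x − f(x)/f'(x), z = x − f(x)²/(f'(x)·(f(x) − f(y))), and x̂ = x − f(x)³/(f'(x)·(f(x) − f(y))·(f(x) − f(z))) are well defined (all denominators are nonzero) and satisfy |x̂ − α| ≤ K·|x − α|⁴. That is, the three-step Newton–Steffensen-type method (3.19) has (at least) fourth order of convergence. -/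
/-- Local data near a simple root. -/
lemma local_data (f : ℝ → ℝ) (I : Set ℝ) (hI : IsOpen I) (α : ℝ) (hαI : α ∈ I)
    (hf : ContDiffOn ℝ 5 f I) (hder : deriv f α ≠ 0) :
    ∃ r > (0 : ℝ), ∃ L > (0 : ℝ),
      (∀ t ∈ Metric.ball α r, HasDerivAt f (deriv f t) t) ∧
      (∀ t ∈ Metric.ball α r, |deriv f t - deriv f α| ≤ |deriv f α| / 2) ∧
      (∀ a ∈ Metric.ball α r, ∀ b ∈ Metric.ball α r,
        |deriv f a - deriv f b| ≤ L * |a - b|) := by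
  have hd : ContDiffOn ℝ 1 (deriv f) I := by
    have h2 : ContDiffOn ℝ (1 + 1) f I := hf.of_le (by norm_num)
    exact ((contDiffOn_succ_iff_deriv_of_isOpen hI).1 h2).2.2
  have hda : ContDiffAt ℝ 1 (deriv f) α := hd.contDiffAt (hI.mem_nhds hαI)
  obtain ⟨K, s, hs, hK⟩ := hda.exists_lipschitzOnWith
  have hc : ∀ᶠ t in nhds α, |deriv f t - deriv f α| < |deriv f α| / 2 := by
    have := Metric.tendsto_nhds.1 hda.continuousAt.tendsto (|deriv f α| / 2)
      (by have := abs_pos.2 hder; positivity)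
    simpa [Real.dist_eq] using this
  have hall : ∀ᶠ t in nhds α, t ∈ I ∧ t ∈ s ∧ |deriv f t - deriv f α| < |deriv f α| / 2 := by
    filter_upwards [hI.mem_nhds hαI, hs, hc] with t h1 h2 h3 using ⟨h1, h2, h3⟩
  obtain ⟨r, hr, hball⟩ := Metric.eventually_nhds_iff_ball.1 hall
  refine ⟨r, hr, K + 1, by positivity, ?_, ?_, ?_⟩
  · intro t ht
    have h5 := hf.contDiffAt (hI.mem_nhds (hball t ht).1)
    exact (h5.differentiableAt (by norm_num)).hasDerivAt
  · intro t ht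
    exact (hball t ht).2.2.le
  · intro a ha b hb
    have := hK.dist_le_mul a (hball a ha).2.1 b (hball b hb).2.1
    rw [Real.dist_eq, Real.dist_eq] at this
    nlinarith [abs_nonneg (a - b)]

lemma lower_bound (f : ℝ → ℝ) (α r c : ℝ)
    (h1 : ∀ t ∈ Metric.ball α r, HasDerivAt f (deriv f t) t)
    (h2 : ∀ t ∈ Metric.ball α r, |deriv f t - c| ≤ |c| / 2)
    (a b : ℝ) (ha : a ∈ Metric.ball α r) (hb : b ∈ Metric.ball α r) :
    |c| / 2 * |a - b| ≤ |f a - f b| := by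
  have key := (convex_ball α r).norm_image_sub_le_of_norm_hasDerivWithin_le
    (f := fun t => f t - c * t) (f' := fun t => deriv f t - c * 1) (C := |c| / 2)
    (fun t ht => ((h1 t ht).sub ((hasDerivAt_id t).const_mul c)).hasDerivWithinAt)
    (fun t ht => by simpa using h2 t ht) hb ha
  simp only [Real.norm_eq_abs] at key
  have e : c * (a - b) = (f a - f b) - (f a - c * a - (f b - c * b)) := by ring
  have h3 : |c| * |a - b| ≤ |f a - f b| + |f a - c * a - (f b - c * b)| := by
    rw [← abs_mul, e]; exact abs_sub _ _
  linarith

lemma newton_bound (f : ℝ → ℝ) (α r L : ℝ) (hr : 0 < r) (hL : 0 < L) (hroot : f α = 0)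
    (h1 : ∀ t ∈ Metric.ball α r, HasDerivAt f (deriv f t) t)
    (h3 : ∀ a ∈ Metric.ball α r, ∀ b ∈ Metric.ball α r,
        |deriv f a - deriv f b| ≤ L * |a - b|)
    (x : ℝ) (hx : x ∈ Metric.ball α r) :
    |(x - α) * deriv f x - f x| ≤ L * |x - α| ^ 2 := by
  have hα : α ∈ Metric.ball α r := Metric.mem_ball_self hr
  have hsub : Set.uIcc α x ⊆ Metric.ball α r := by
    rw [← segment_eq_uIcc]; exact (convex_ball α r).segment_subset hα hx
  have key := (convex_uIcc α x).norm_image_sub_le_of_norm_hasDerivWithin_le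
    (f := fun t => f t - deriv f x * t) (f' := fun t => deriv f t - deriv f x * 1)
    (C := L * |x - α|)
    (fun t ht => ((h1 t (hsub ht)).sub
      ((hasDerivAt_id t).const_mul (deriv f x))).hasDerivWithinAt)
    (fun t ht => by
      have h4 := h3 t (hsub ht) x hx
      have h5 : |t - x| ≤ |x - α| := by
        rw [abs_sub_comm t x]; exact Set.abs_sub_right_of_mem_uIcc ht
      simp only [Real.norm_eq_abs, mul_one]
      exact h4.trans (by gcongr)) Set.left_mem_uIcc Set.right_mem_uIcc
  simp only [Real.norm_eq_abs, hroot] at key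
  rw [abs_sub_comm] at key
  calc _ = |0 - deriv f x * α - (f x - deriv f x * x)| := by congr 1; ring
    _ ≤ _ := key
    _ = _ := by ring

lemma secant_num (f : ℝ → ℝ) (α r L : ℝ) (hr : 0 < r) (hL : 0 < L) (hroot : f α = 0)
    (h1 : ∀ t ∈ Metric.ball α r, HasDerivAt f (deriv f t) t)
    (h3 : ∀ a ∈ Metric.ball α r, ∀ b ∈ Metric.ball α r,
        |deriv f a - deriv f b| ≤ L * |a - b|)
    (a b : ℝ) (ha : a ∈ Metric.ball α r) (hb : b ∈ Metric.ball α r) :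
    |(b - α) * f a - (a - α) * f b| ≤ L * |a - α| * |b - α| * |a - b| := by
  have hmem : ∀ u ∈ Metric.ball α r, ∀ s ∈ Set.Icc (0 : ℝ) 1,
      α + s * (u - α) ∈ Metric.ball α r := by
    intro u hu s hs
    rw [Metric.mem_ball, Real.dist_eq] at *
    rw [add_sub_cancel_left, abs_mul, abs_of_nonneg hs.1]
    nlinarith [hs.1, hs.2, abs_nonneg (u - α)]
  have hd : ∀ u ∈ Metric.ball α r, ∀ s ∈ Set.Icc (0 : ℝ) 1,
      HasDerivAt (fun s => f (α + s * (u - α))) (deriv f (α + s * (u - α)) * (1 * (u - α))) s := by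
    intro u hu s hs
    exact (h1 _ (hmem u hu s hs)).comp s
      (((hasDerivAt_id s).mul_const (u - α)).const_add α)
  have key := (convex_Icc (0 : ℝ) 1).norm_image_sub_le_of_norm_hasDerivWithin_le
    (f := fun s => (b - α) * f (α + s * (a - α)) - (a - α) * f (α + s * (b - α)))
    (C := L * |a - α| * |b - α| * |a - b|)
    (fun s hs => (((hd a ha s hs).const_mul (b - α)).sub
      ((hd b hb s hs).const_mul (a - α))).hasDerivWithinAt)
    (fun s hs => by
      have h4 := h3 _ (hmem a ha s hs) _ (hmem b hb s hs)
      have h5 : |α + s * (a - α) - (α + s * (b - α))| ≤ |a - b| := by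
        rw [show α + s * (a - α) - (α + s * (b - α)) = s * (a - b) by ring, abs_mul,
          abs_of_nonneg hs.1]
        nlinarith [hs.2, abs_nonneg (a - b)]
      rw [Real.norm_eq_abs]
      calc _ = |(a - α) * (b - α) *
            (deriv f (α + s * (a - α)) - deriv f (α + s * (b - α)))| := by congr 1; ring
        _ = |a - α| * |b - α| * |deriv f (α + s * (a - α)) - deriv f (α + s * (b - α))| := by
            rw [abs_mul, abs_mul]
        _ ≤ |a - α| * |b - α| * (L * |a - b|) := by
            gcongr; exact h4.trans (by gcongr)
        _ = _ := by ring)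
    (Set.left_mem_Icc.2 zero_le_one) (Set.right_mem_Icc.2 zero_le_one)
  simpa [hroot] using key

lemma secant_bound (f : ℝ → ℝ) (α r L c : ℝ) (hr : 0 < r) (hL : 0 < L) (hc : c ≠ 0)
    (hroot : f α = 0)
    (h1 : ∀ t ∈ Metric.ball α r, HasDerivAt f (deriv f t) t)
    (h2 : ∀ t ∈ Metric.ball α r, |deriv f t - c| ≤ |c| / 2)
    (h3 : ∀ a ∈ Metric.ball α r, ∀ b ∈ Metric.ball α r,
        |deriv f a - deriv f b| ≤ L * |a - b|)
    (a b : ℝ) (ha : a ∈ Metric.ball α r) (hb : b ∈ Metric.ball α r) (hab : a ≠ b) :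
    f a - f b ≠ 0 ∧
    |a - f a * (a - b) / (f a - f b) - α| ≤ L / (|c| / 2) * |a - α| * |b - α| := by
  have hm : 0 < |c| / 2 := by have := abs_pos.2 hc; positivity
  have hd : 0 < |a - b| := abs_pos.2 (sub_ne_zero.2 hab)
  have hlow := lower_bound f α r c h1 h2 a b ha hb
  have hpos : 0 < |f a - f b| := lt_of_lt_of_le (by positivity) hlow
  have hne : f a - f b ≠ 0 := abs_pos.1 hpos
  refine ⟨hne, ?_⟩
  have hn := secant_num f α r L hr hL hroot h1 h3 a b ha hb
  have e : a - f a * (a - b) / (f a - f b) - α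
      = ((b - α) * f a - (a - α) * f b) / (f a - f b) := by
    field_simp; ring
  rw [e, abs_div, div_le_iff₀ hpos]
  calc _ ≤ _ := hn
    _ = L / (|c| / 2) * |a - α| * |b - α| * (|c| / 2 * |a - b|) := by field_simp
    _ ≤ _ := by gcongr

/-- The three-step Newton–Steffensen-type method (3.19) has (at least) fourth order
of convergence: if `f` is five times continuously differentiable on an open interval `I`
and `α ∈ I` is a simple root of `f`, then there are `δ > 0` and `K > 0` such that for all
`x` with `0 < |x - α| < δ` the steps `y`, `z`, `x̂` are well defined and
`|x̂ - α| ≤ K * |x - α|^4`. -/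
theorem three_step_method_fourth_order
    (f : ℝ → ℝ) (I : Set ℝ) (hI : IsOpen I) (α : ℝ) (hαI : α ∈ I)
    (hf : ContDiffOn ℝ 5 f I) (hroot : f α = 0) (hder : deriv f α ≠ 0) :
    ∃ δ > (0 : ℝ), ∃ K > (0 : ℝ), ∀ x : ℝ, 0 < |x - α| → |x - α| < δ →
      deriv f x ≠ 0 ∧
      (let y := x - f x / deriv f x
       deriv f x * (f x - f y) ≠ 0 ∧
       (let z := x - (f x) ^ 2 / (deriv f x * (f x - f y))
        deriv f x * (f x - f y) * (f x - f z) ≠ 0 ∧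
        |x - (f x) ^ 3 / (deriv f x * (f x - f y) * (f x - f z)) - α| ≤ K * |x - α| ^ 4)) := by
  obtain ⟨r, hr, L, hL, h1, h2, h3⟩ := local_data f I hI α hαI hf hder
  have hm : 0 < |deriv f α| / 2 := by have := abs_pos.2 hder; positivity
  have hsec := secant_bound f α r L (deriv f α) hr hL hder hroot h1 h2 h3
  obtain ⟨C, hC⟩ : ∃ C, C = L / (|deriv f α| / 2) := ⟨_, rfl⟩
  have hCpos : 0 < C := by rw [hC]; positivity
  rw [← hC] at hsec
  refine ⟨min r (1 / (2 * C)), by positivity, C ^ 3, by positivity, ?_⟩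
  intro x hx0 hxδ
  have hxr : |x - α| < r := lt_of_lt_of_le hxδ (min_le_left _ _)
  have hxC : C * |x - α| ≤ 1 / 2 := by
    have h := (lt_of_lt_of_le hxδ (min_le_right _ _)).le
    rw [le_div_iff₀ (by positivity)] at h
    linarith
  have hxb : x ∈ Metric.ball α r := by rwa [Metric.mem_ball, Real.dist_eq]
  have hαb : α ∈ Metric.ball α r := Metric.mem_ball_self hr
  have hdlow : |deriv f α| / 2 ≤ |deriv f x| := by
    have h4 := h2 x hxb
    have h5 := abs_sub_abs_le_abs_sub (deriv f α) (deriv f x)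
    rw [abs_sub_comm] at h5
    linarith
  have hdpos : 0 < |deriv f x| := lt_of_lt_of_le hm hdlow
  have hdne : deriv f x ≠ 0 := abs_pos.1 hdpos
  refine ⟨hdne, ?_⟩
  intro y
  have hxy : x - y = f x / deriv f x := by simp only [y]; ring
  have hye : |y - α| ≤ C * |x - α| ^ 2 := by
    have hn := newton_bound f α r L hr hL hroot h1 h3 x hxb
    have e : y - α = ((x - α) * deriv f x - f x) / deriv f x := by
      simp only [y]; field_simp; ring
    rw [e, abs_div, div_le_iff₀ hdpos]
    calc _ ≤ _ := hn
      _ = C * |x - α| ^ 2 * (|deriv f α| / 2) := by rw [hC]; field_simp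
      _ ≤ _ := by gcongr
  have hyh : |y - α| ≤ |x - α| / 2 := by nlinarith
  have hyb : y ∈ Metric.ball α r := by rw [Metric.mem_ball, Real.dist_eq]; linarith
  have hxyne : x ≠ y := by
    intro h; rw [← h] at hyh; linarith
  obtain ⟨hfy, hzb⟩ := hsec x y hxb hyb hxyne
  refine ⟨mul_ne_zero hdne hfy, ?_⟩
  intro z
  have hz : z = x - f x * (x - y) / (f x - f y) := by
    simp only [z]; rw [hxy]; field_simp
  have hxz : x - z = (f x) ^ 2 / (deriv f x * (f x - f y)) := by simp only [z]; ring
  rw [← hz] at hzb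
  have hze : |z - α| ≤ C ^ 2 * |x - α| ^ 3 := by
    calc _ ≤ _ := hzb
      _ ≤ C * |x - α| * (C * |x - α| ^ 2) := by gcongr
      _ = _ := by ring
  have hzh : |z - α| ≤ |x - α| / 2 := by
    calc _ ≤ _ := hzb
      _ ≤ 1 / 2 * (|x - α| / 2) := by gcongr
      _ ≤ _ := by linarith
  have hzball : z ∈ Metric.ball α r := by rw [Metric.mem_ball, Real.dist_eq]; linarith
  have hxzne : x ≠ z := by
    intro h; rw [← h] at hzh; linarith
  obtain ⟨hfz, hfin⟩ := hsec x z hxb hzball hxzne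
  refine ⟨mul_ne_zero (mul_ne_zero hdne hfy) hfz, ?_⟩
  have e : (f x) ^ 3 / (deriv f x * (f x - f y) * (f x - f z))
      = f x * (x - z) / (f x - f z) := by
    rw [hxz, ← mul_div_assoc, div_div, pow_succ' (f x) 2]
  rw [e]
  calc _ ≤ _ := hfin
    _ ≤ C * |x - α| * (C ^ 2 * |x - α| ^ 3) := by gcongr
    _ = _ := by ring
end

section
/- Let f : ℝ → ℝ be five times continuously differentiable on an open interval I, and let α ∈ I be a simple root of f (i.e. f(α) = 0 and f'(α) ≠ 0). Set c₂ = f''(α)/(2·f'(α)). Then there exist δ > 0 and K > 0 such that for every x with 0 < |x − α| < δ, the point x̂ produced by the three-step method (3.19) satisfies |x̂ − α − c₂³·(x − α)⁴| ≤ K·|x − α|⁵. In other words, the error of the method satisfies e_{n+1} = c₂³·e_n⁴ + O(e_n⁵), so the asymptotic error constant is (f''(α)/(2f'(α)))³. -/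
open Filter Topology Asymptotics

/-- `u(e) = k e^n + O(e^(n+1))` as `e → 0`, `e ≠ 0`. -/
def Lead (n : ℕ) (k : ℝ) (u : ℝ → ℝ) : Prop :=
  (fun e => u e - k * e ^ n) =O[𝓝[≠] (0 : ℝ)] fun e => e ^ (n + 1)

lemma pow_bigO {m n : ℕ} (h : m ≤ n) :
    (fun e : ℝ => e ^ n) =O[𝓝[≠] (0 : ℝ)] fun e => e ^ m := by
  obtain ⟨j, rfl⟩ := Nat.exists_eq_add_of_le h
  have hb : (fun e : ℝ => e ^ j) =O[𝓝[≠] (0 : ℝ)] fun _ => (1 : ℝ) := by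
    have : Tendsto (fun e : ℝ => e ^ j) (𝓝[≠] (0 : ℝ)) (𝓝 (0 ^ j)) :=
      ((continuous_pow j).tendsto 0).mono_left nhdsWithin_le_nhds
    exact this.isBigO_one ℝ
  simpa [pow_add] using (isBigO_refl (fun e : ℝ => e ^ m) (𝓝[≠] (0 : ℝ))).mul hb

lemma Lead.isBigO {n : ℕ} {k : ℝ} {u : ℝ → ℝ} (h : Lead n k u) :
    u =O[𝓝[≠] (0 : ℝ)] fun e => e ^ n := by
  have h1 := (h.trans (pow_bigO (Nat.le_succ n))).add
    ((isBigO_refl (fun e : ℝ => e ^ n) (𝓝[≠] (0 : ℝ))).const_mul_left k)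
  simpa using h1

lemma Lead.lower {n : ℕ} {k : ℝ} {u : ℝ → ℝ} (hk : k ≠ 0) (h : Lead n k u) :
    (fun e => e ^ n) =O[𝓝[≠] (0 : ℝ)] u ∧ ∀ᶠ e in 𝓝[≠] (0 : ℝ), u e ≠ 0 := by
  have hlo : (fun e => u e - k * e ^ n) =o[𝓝[≠] (0 : ℝ)] fun e => k * e ^ n := by
    refine h.trans_isLittleO ?_
    have : (fun e : ℝ => e) =o[𝓝[≠] (0 : ℝ)] fun _ => (1 : ℝ) := by
      rw [isLittleO_one_iff]
      exact tendsto_id.mono_left nhdsWithin_le_nhds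
    have h2 := (isBigO_refl (fun e : ℝ => e ^ n) (𝓝[≠] (0 : ℝ))).mul_isLittleO this
    have h3 : (fun e : ℝ => e ^ (n + 1)) =o[𝓝[≠] (0 : ℝ)] fun e => e ^ n := by
      simpa [pow_succ] using h2
    exact h3.const_mul_right hk
  have h1 : (fun e => k * e ^ n) =O[𝓝[≠] (0 : ℝ)] u := by
    have := hlo.right_isBigO_add
    simpa using this
  have h2 : (fun e => e ^ n) =O[𝓝[≠] (0 : ℝ)] u :=
    (isBigO_const_mul_left_iff hk).1 h1
  refine ⟨h2, ?_⟩
  obtain ⟨C, hC⟩ := h2.bound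
  filter_upwards [hC, self_mem_nhdsWithin] with e he hne h0
  rw [h0] at he
  have : 0 < ‖e ^ n‖ := norm_pos_iff.2 (pow_ne_zero _ hne)
  rw [norm_zero, mul_zero] at he
  exact absurd he (not_le.2 this)

lemma Lead.div {n j : ℕ} {p a : ℝ} {N D : ℝ → ℝ} (ha : a ≠ 0)
    (hN : Lead (n + j) p N) (hD : Lead j a D) :
    Lead n (p / a) (fun e => N e / D e) := by
  obtain ⟨hlow, hne⟩ := hD.lower ha
  have hinv : (fun e => (D e)⁻¹) =O[𝓝[≠] (0 : ℝ)] fun e => (e ^ j)⁻¹ := by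
    refine hlow.inv_rev ?_
    filter_upwards [self_mem_nhdsWithin] with e he h0
    exact absurd h0 (pow_ne_zero _ he)
  have hnum : (fun e => (N e - p * e ^ (n + j)) - (p / a) * (e ^ n * (D e - a * e ^ j)))
      =O[𝓝[≠] (0 : ℝ)] fun e => e ^ (n + j + 1) := by
    refine IsBigO.sub hN (IsBigO.const_mul_left ?_ _)
    have := (isBigO_refl (fun e : ℝ => e ^ n) (𝓝[≠] (0 : ℝ))).mul hD
    simpa [← pow_add, add_assoc] using this
  refine (hnum.mul hinv).congr' ?_ ?_
  · filter_upwards [hne] with e he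
    field_simp
    ring
  · filter_upwards [self_mem_nhdsWithin] with e he
    have : e ≠ 0 := he
    field_simp
    ring

/-- The secant step through `(e, F e)` and `(u, F u)`. -/
lemma Lead.secant {F u : ℝ → ℝ} {a b k : ℝ} {n : ℕ} (ha : a ≠ 0) (hn : 2 ≤ n)
    (hF : (fun t => F t - a * t - b * t ^ 2) =O[𝓝 (0 : ℝ)] fun t => t ^ 3)
    (hu : Lead n k u) :
    (∀ᶠ e in 𝓝[≠] (0 : ℝ), F e - F (u e) ≠ 0) ∧
    Lead (n + 1) (k * b / a) (fun e => (u e * F e - e * F (u e)) / (F e - F (u e))) := by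
  have hF' : (fun t => F t - a * t - b * t ^ 2) =O[𝓝[≠] (0 : ℝ)] fun t => t ^ 3 :=
    hF.mono nhdsWithin_le_nhds
  have huO := hu.isBigO
  have hu0 : Tendsto u (𝓝[≠] (0 : ℝ)) (𝓝 0) := by
    refine (huO.trans (pow_bigO (m := 1) (by omega))).trans_tendsto ?_
    simp only [pow_one]
    exact tendsto_id.mono_left nhdsWithin_le_nhds
  have hFu : (fun e => F (u e) - a * u e - b * u e ^ 2) =O[𝓝[≠] (0 : ℝ)]
      fun e => e ^ (n * 3) := by
    have h1 := hF.comp_tendsto hu0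
    have h2 := huO.pow 3
    refine IsBigO.trans h1 ?_
    simpa [Function.comp_def, pow_mul] using h2
  have hu2 : (fun e => u e ^ 2) =O[𝓝[≠] (0 : ℝ)] fun e => e ^ (n * 2) := by
    simpa [pow_mul] using huO.pow 2
  have he : (fun e : ℝ => e) =O[𝓝[≠] (0 : ℝ)] fun e => e ^ 1 := by
    simpa using isBigO_refl (fun e : ℝ => e) (𝓝[≠] (0 : ℝ))
  have hD : Lead 1 a (fun e => F e - F (u e)) := by
    have t1 := hF'.trans (pow_bigO (m := 2) (by omega))
    have t2 := (isBigO_refl (fun e : ℝ => e ^ 2) (𝓝[≠] (0 : ℝ))).const_mul_left b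
    have t3 := hFu.trans (pow_bigO (m := 2) (by omega))
    have t4 := (huO.trans (pow_bigO (m := 2) (by omega))).const_mul_left a
    have t5 := (hu2.trans (pow_bigO (m := 2) (by omega))).const_mul_left b
    refine ((((t1.add t2).sub t3).sub t4).sub t5).congr_left ?_
    intro e
    ring
  have hN : Lead (n + 1 + 1) (k * b) (fun e => u e * F e - e * F (u e)) := by
    have t1 : (fun e => u e * (F e - a * e - b * e ^ 2)) =O[𝓝[≠] (0 : ℝ)]
        fun e => e ^ (n + 1 + 1 + 1) := by
      simpa [← pow_add, add_assoc] using huO.mul hF'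
    have t2 : (fun e => e * (F (u e) - a * u e - b * u e ^ 2)) =O[𝓝[≠] (0 : ℝ)]
        fun e => e ^ (n + 1 + 1 + 1) := by
      have := he.mul hFu
      simp only [← pow_add] at this
      exact this.trans (pow_bigO (by omega))
    have t3 : (fun e => b * (e * u e ^ 2)) =O[𝓝[≠] (0 : ℝ)]
        fun e => e ^ (n + 1 + 1 + 1) := by
      have := he.mul hu2
      simp only [← pow_add] at this
      exact (this.trans (pow_bigO (by omega))).const_mul_left b
    have t4 : (fun e => b * (e ^ 2 * (u e - k * e ^ n))) =O[𝓝[≠] (0 : ℝ)]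
        fun e => e ^ (n + 1 + 1 + 1) := by
      have := (isBigO_refl (fun e : ℝ => e ^ 2) (𝓝[≠] (0 : ℝ))).mul hu
      simp only [← pow_add] at this
      exact (this.trans (pow_bigO (by omega))).const_mul_left b
    refine (((t1.sub t2).sub t3).add t4).congr_left ?_
    intro e
    ring
  exact ⟨(hD.lower ha).2, Lead.div ha hN hD⟩

/-- Integrating a big-O bound. -/
lemma bigO_integrate {H H' : ℝ → ℝ} {n : ℕ} (h0 : H 0 = 0)
    (hd : ∀ᶠ t in 𝓝 (0 : ℝ), HasDerivAt H (H' t) t)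
    (hO : H' =O[𝓝 (0 : ℝ)] fun t => t ^ n) :
    H =O[𝓝 (0 : ℝ)] fun t => t ^ (n + 1) := by
  obtain ⟨C, hC⟩ := hO.bound
  obtain ⟨r, hr, hball⟩ := Metric.eventually_nhds_iff_ball.1 (hd.and hC)
  refine IsBigO.of_bound |C| ?_
  filter_upwards [Metric.ball_mem_nhds (0 : ℝ) hr] with t ht
  have ht' : |t| < r := by simpa using ht
  have hsub : Metric.closedBall (0 : ℝ) |t| ⊆ Metric.ball 0 r :=
    Metric.closedBall_subset_ball ht'
  have hC0 : ∀ s ∈ Metric.closedBall (0 : ℝ) |t|, ‖H' s‖ ≤ |C| * |t| ^ n := by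
    intro s hs
    have h1 := (hball s (hsub hs)).2
    have hs' : |s| ≤ |t| := by simpa using hs
    rw [norm_pow, Real.norm_eq_abs s] at h1
    calc ‖H' s‖ ≤ C * |s| ^ n := h1
      _ ≤ |C| * |s| ^ n := by gcongr; exact le_abs_self C
      _ ≤ |C| * |t| ^ n := by gcongr
  have hmvt := (convex_closedBall (0 : ℝ) |t|).norm_image_sub_le_of_norm_hasDerivWithin_le
    (f := H) (f' := H') (fun s hs => ((hball s (hsub hs)).1).hasDerivWithinAt) hC0
    (x := 0) (y := t) (by simp) (by simp)
  rw [h0, sub_zero, sub_zero] at hmvt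
  rw [norm_pow, pow_succ, ← mul_assoc]
  exact hmvt

theorem three_step_method_error_equation
    (f : ℝ → ℝ) (I : Set ℝ) (hI : IsOpen I) (α : ℝ) (hαI : α ∈ I)
    (hf : ContDiffOn ℝ 5 f I) (hroot : f α = 0) (hder : deriv f α ≠ 0)
    (c₂ : ℝ) (hc₂ : c₂ = iteratedDeriv 2 f α / (2 * deriv f α)) :
    ∃ δ > (0 : ℝ), ∃ K > (0 : ℝ), ∀ x : ℝ, 0 < |x - α| → |x - α| < δ →
      deriv f x ≠ 0 ∧
      (let y := x - f x / deriv f x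
       deriv f x * (f x - f y) ≠ 0 ∧
       (let z := x - (f x) ^ 2 / (deriv f x * (f x - f y))
        deriv f x * (f x - f y) * (f x - f z) ≠ 0 ∧
        |x - (f x) ^ 3 / (deriv f x * (f x - f y) * (f x - f z)) - α
            - c₂ ^ 3 * (x - α) ^ 4| ≤ K * |x - α| ^ 5)) := by
  have hf1 : ContDiffOn ℝ 4 (deriv f) I := hf.deriv_of_isOpen hI (by norm_num)
  have hf2 : ContDiffOn ℝ 3 (deriv (deriv f)) I := hf1.deriv_of_isOpen hI (by norm_num)
  have hI0 : ∀ᶠ t in 𝓝 (0 : ℝ), α + t ∈ I := by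
    have : Tendsto (fun t : ℝ => α + t) (𝓝 0) (𝓝 α) := by
      have hc : Continuous fun t : ℝ => α + t := by fun_prop
      have h := hc.tendsto 0
      rwa [add_zero] at h
    exact this.eventually (hI.mem_nhds hαI)
  have hd0 : ∀ t, α + t ∈ I → HasDerivAt (fun t => f (α + t)) (deriv f (α + t)) t := by
    intro t ht
    have := ((hf.differentiableOn (by norm_num)).differentiableAt (hI.mem_nhds ht)).hasDerivAt
    exact this.comp_const_add α t
  have hd1 : ∀ t, α + t ∈ I →
      HasDerivAt (fun t => deriv f (α + t)) (deriv (deriv f) (α + t)) t := by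
    intro t ht
    have := ((hf1.differentiableOn (by norm_num)).differentiableAt (hI.mem_nhds ht)).hasDerivAt
    exact this.comp_const_add α t
  have hd2 : ∀ t, α + t ∈ I →
      HasDerivAt (fun t => deriv (deriv f) (α + t)) (deriv (deriv (deriv f)) (α + t)) t := by
    intro t ht
    have := ((hf2.differentiableOn (by norm_num)).differentiableAt (hI.mem_nhds ht)).hasDerivAt
    exact this.comp_const_add α t
  obtain ⟨a, ha⟩ : ∃ a, a = deriv f α := ⟨_, rfl⟩
  obtain ⟨b, hb⟩ : ∃ b, b = deriv (deriv f) α / 2 := ⟨_, rfl⟩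
  have ha0 : a ≠ 0 := ha ▸ hder
  have hcab : c₂ = b / a := by
    rw [hc₂, iteratedDeriv_succ, iteratedDeriv_one, hb, ha]
    field_simp
  have hO2 : (fun t => deriv (deriv f) (α + t) - 2 * b) =O[𝓝 (0 : ℝ)] fun t => t ^ 1 := by
    have := (hd2 0 (by simpa using hαI)).isBigO_sub
    refine this.congr ?_ ?_
    · intro t; simp [hb]; ring
    · intro t; simp
  have hO1 : (fun t => deriv f (α + t) - a - 2 * b * t) =O[𝓝 (0 : ℝ)] fun t => t ^ 2 := by
    refine bigO_integrate (by simp [ha]) ?_ hO2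
    filter_upwards [hI0] with t ht
    have := ((hd1 t ht).sub_const a).sub ((hasDerivAt_id t).const_mul (2 * b))
    rw [mul_one] at this
    exact this
  have hO0 : (fun t => f (α + t) - a * t - b * t ^ 2) =O[𝓝 (0 : ℝ)] fun t => t ^ 3 := by
    refine bigO_integrate (by simp [hroot]) ?_ hO1
    filter_upwards [hI0] with t ht
    have := ((hd0 t ht).sub ((hasDerivAt_id t).const_mul a)).sub
      (((hasDerivAt_id t).pow 2).const_mul b)
    refine (this.congr_deriv ?_ :)
    simp
    ring
  -- first step
  have hD : Lead 0 a (fun e => deriv f (α + e)) := by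
    have t1 := (hO1.mono nhdsWithin_le_nhds).trans (pow_bigO (m := 1) (by omega))
    have t2 := (isBigO_refl (fun e : ℝ => e ^ 1) (𝓝[≠] (0 : ℝ))).const_mul_left (2 * b)
    refine (t1.add t2).congr_left ?_
    intro e; ring
  have hN : Lead (2 + 0) b (fun e => e * deriv f (α + e) - f (α + e)) := by
    have he : (fun e : ℝ => e) =O[𝓝[≠] (0 : ℝ)] fun e => e ^ 1 := by
      simpa using isBigO_refl (fun e : ℝ => e) (𝓝[≠] (0 : ℝ))
    have t1 := he.mul (hO1.mono nhdsWithin_le_nhds)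
    simp only [← pow_add] at t1
    refine (t1.sub (hO0.mono nhdsWithin_le_nhds)).congr_left ?_
    intro e; ring
  have hDne := (hD.lower ha0).2
  have hy := Lead.div ha0 hN hD
  obtain ⟨hyne, hz⟩ := hy.secant ha0 le_rfl hO0
  obtain ⟨hzne, hw⟩ := hz.secant ha0 (by norm_num) hO0
  obtain ⟨K, hK, hbd⟩ := IsBigO.exists_pos hw
  have hbound := hbd.bound
  have hall := hDne.and (hyne.and (hzne.and hbound))
  rw [eventually_nhdsWithin_iff, Metric.eventually_nhds_iff] at hall
  obtain ⟨δ, hδ, hall⟩ := hall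
  refine ⟨δ, hδ, K, hK, ?_⟩
  intro x hx0 hxδ
  obtain ⟨e, rfl⟩ : ∃ e, x = α + e := ⟨x - α, by ring⟩
  simp only [add_sub_cancel_left] at hx0 hxδ ⊢
  have hall := hall (y := e) (by simpa using hxδ) (by simpa using hx0)
  obtain ⟨g1, g2, g3, g4⟩ := hall
  set F := f (α + e) with hFdef
  set D := deriv f (α + e) with hDdef
  have ey : α + e - F / D = α + (e * D - F) / D := by field_simp; ring
  rw [ey]
  set u := (e * D - F) / D with hu
  set Y := f (α + u) with hY
  have ez : α + e - F ^ 2 / (D * (F - Y)) = α + (u * F - e * Y) / (F - Y) := by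
    rw [hu]; field_simp; ring
  rw [ez]
  set v := (u * F - e * Y) / (F - Y) with hv
  set Z := f (α + v) with hZ
  have ew : α + e - F ^ 3 / (D * (F - Y) * (F - Z)) - α = (v * F - e * Z) / (F - Z) := by
    rw [hv, hu]; field_simp; ring
  refine ⟨g1, mul_ne_zero g1 g2, mul_ne_zero (mul_ne_zero g1 g2) g3, ?_⟩
  rw [ew]
  rw [Real.norm_eq_abs, norm_pow, Real.norm_eq_abs] at g4
  have hc : c₂ ^ 3 = b / a * b / a * b / a := by rw [hcab]; ring
  rw [hc]
  exact g4
end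

section
/- Let f : ℝ → ℝ be five times continuously differentiable on an open interval I, and let α ∈ I be a simple root of f (i.e. f(α) = 0 and f'(α) ≠ 0). Set c₂ = f''(α)/(2·f'(α)) and c₃ = f'''(α)/(6·f'(α)). Then there exist δ > 0 and K > 0 such that for every x with 0 < |x − α| < δ, the points y = x − f(x)/f'(x) and z = x − f(x)²/(f'(x)·(f(x) − f(y))) are well defined and satisfy |z − α − c₂²·(x − α)³ − (3c₂c₃ − 3c₂³)·(x − α)⁴| ≤ K·|x − α|⁵ (equation (3.25) of the paper: z_n = α + c₂²e_n³ + (3c₂c₃ − 3c₂³)e_n⁴ + O(e_n⁵)). -/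
open Set Filter Topology in
/-- Local Taylor bound with `iteratedDeriv` coefficients. -/
theorem ns_taylor (f : ℝ → ℝ) (I : Set ℝ) (hI : IsOpen I) (α : ℝ) (hα : α ∈ I) (n : ℕ)
    (hf : ContDiffOn ℝ n f I) :
    ∃ δ > (0 : ℝ), ∃ R > (0 : ℝ), ∀ x, |x - α| < δ → ∃ r, |r| ≤ R ∧
      f x = ∑ k ∈ Finset.range n, ((k.factorial : ℝ)⁻¹ * (x - α) ^ k) * iteratedDeriv k f α
        + r * (x - α) ^ n := by
  obtain ⟨ε, hε, hball⟩ := Metric.isOpen_iff.1 hI α hα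
  have hαs : α ∈ Metric.ball α ε := Metric.mem_ball_self hε
  have h := taylor_isLittleO (convex_ball α ε) hαs (hf.mono hball)
  rw [Metric.isOpen_ball.nhdsWithin_eq hαs] at h
  have h1 := h.def one_pos
  obtain ⟨δ, hδ, h2⟩ := Metric.eventually_nhds_iff.1 h1
  set L : ℝ := ((n.factorial : ℝ)⁻¹) * iteratedDeriv n f α with hL
  refine ⟨δ, hδ, 1 + |L|, by positivity, fun x hx => ?_⟩
  have h3 := h2 (y := x) (by rwa [Real.dist_eq])
  rw [taylor_within_apply, Finset.sum_range_succ] at h3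
  simp only [iteratedDerivWithin_of_isOpen Metric.isOpen_ball hαs, smul_eq_mul,
    Real.norm_eq_abs, one_mul] at h3
  set S := ∑ k ∈ Finset.range n, ((k.factorial : ℝ)⁻¹ * (x - α) ^ k) * iteratedDeriv k f α
  have h4 : f x - (S + ((n.factorial : ℝ)⁻¹ * (x - α) ^ n) * iteratedDeriv n f α)
      = f x - S - L * (x - α) ^ n := by rw [hL]; ring
  rw [h4] at h3
  by_cases hz : (x - α) ^ n = 0
  · refine ⟨0, by simpa using by positivity, ?_⟩
    rw [hz] at h3 ⊢
    simp only [mul_zero, sub_zero, abs_zero, abs_nonpos_iff] at h3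
    linarith
  · refine ⟨(f x - S - L * (x - α) ^ n) / (x - α) ^ n + L, ?_, ?_⟩
    · refine (abs_add_le _ _).trans (add_le_add ?_ le_rfl)
      rw [abs_div]
      exact div_le_one_of_le₀ h3 (abs_nonneg _)
    · field_simp
      ring

theorem ns_bound (F : ℝ × ℝ × ℝ × ℝ × ℝ → ℝ) (hF : Continuous F) (R : ℝ) :
    ∃ K > (0 : ℝ), ∀ a b c d e : ℝ, |a| ≤ R → |b| ≤ R → |c| ≤ R → |d| ≤ R → |e| ≤ R →
      |F (a, b, c, d, e)| ≤ K := by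
  obtain ⟨K, hK⟩ := (isCompact_closedBall (0 : ℝ × ℝ × ℝ × ℝ × ℝ) R).exists_bound_of_continuousOn
    hF.continuousOn
  refine ⟨max K 1, by positivity, fun a b c d e ha hb hc hd he => (hK _ ?_).trans (le_max_left _ _)⟩
  rw [mem_closedBall_zero_iff]
  simp only [Prod.norm_def, Real.norm_eq_abs]
  simp [ha, hb, hc, hd, he]

theorem ns_half (e g K δ : ℝ) (he : |e| < δ) (hg : |g| ≤ K) (hK : δ * K ≤ 1 / 2) :
    1 / 2 ≤ 1 + e * g := by
  have h1 : |e * g| ≤ δ * K := by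
    rw [abs_mul]
    exact mul_le_mul he.le hg (abs_nonneg _) ((abs_nonneg e).trans he.le)
  have := neg_abs_le (e * g)
  linarith


set_option maxHeartbeats 4000000

/-- Equation (3.25): the Newton–Steffensen iterate
`z = x - f(x)²/(f'(x)(f(x) - f(y)))`, with `y` the Newton iterate, satisfies
`z = α + c₂² e³ + (3 c₂ c₃ - 3 c₂³) e⁴ + O(e⁵)` where `e = x - α`. -/
theorem newton_steffensen_step_expansion
    (f : ℝ → ℝ) (I : Set ℝ) (hI : IsOpen I) (α : ℝ) (hαI : α ∈ I)
    (hf : ContDiffOn ℝ 5 f I) (hroot : f α = 0) (hder : deriv f α ≠ 0)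
    (c₂ c₃ : ℝ) (hc₂ : c₂ = iteratedDeriv 2 f α / (2 * deriv f α))
    (hc₃ : c₃ = iteratedDeriv 3 f α / (6 * deriv f α)) :
    ∃ δ > (0 : ℝ), ∃ K > (0 : ℝ), ∀ x : ℝ, 0 < |x - α| → |x - α| < δ →
      deriv f x ≠ 0 ∧
      (let y := x - f x / deriv f x
       deriv f x * (f x - f y) ≠ 0 ∧
       |x - (f x) ^ 2 / (deriv f x * (f x - f y)) - α
           - c₂ ^ 2 * (x - α) ^ 3 - (3 * c₂ * c₃ - 3 * c₂ ^ 3) * (x - α) ^ 4|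
         ≤ K * |x - α| ^ 5) := by


  obtain ⟨δ₁, hδ₁, R₁, hR₁, T1⟩ := ns_taylor f I hI α hαI 5 (by exact_mod_cast hf)
  have hf' : ContDiffOn ℝ (4 : ℕ) (deriv f) I :=
    hf.deriv_of_isOpen hI (by norm_num)
  obtain ⟨δ₂, hδ₂, R₂, hR₂, T2⟩ := ns_taylor (deriv f) I hI α hαI 4 hf'
  obtain ⟨δ₃, hδ₃, R₃, hR₃, T3⟩ := ns_taylor f I hI α hαI 3
    (hf.of_le (by norm_cast))
  obtain ⟨D, hD⟩ : ∃ D, D = deriv f α := ⟨_, rfl⟩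
  rw [← hD] at hder hc₂ hc₃
  obtain ⟨c₄, hc₄⟩ : ∃ c, c = iteratedDeriv 4 f α / (24 * D) := ⟨_, rfl⟩
  have i2 : iteratedDeriv 2 f α = 2 * D * c₂ := by rw [hc₂]; field_simp
  have i3 : iteratedDeriv 3 f α = 6 * D * c₃ := by rw [hc₃]; field_simp
  have i4 : iteratedDeriv 4 f α = 24 * D * c₄ := by rw [hc₄]; field_simp
  -- uniform bound for the remainders
  obtain ⟨R, hR⟩ : ∃ R, R = 1 + (R₁ + R₂ + R₃) / |D| := ⟨_, rfl⟩
  have hDpos : 0 < |D| := abs_pos.2 hder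
  have hR1 : 1 ≤ R := by rw [hR]; have : 0 ≤ (R₁ + R₂ + R₃) / |D| := by positivity
                         linarith
  have hRb : ∀ r : ℝ, |r| ≤ R₁ + R₂ + R₃ → |r / D| ≤ R := by
    intro r hr
    rw [hR, abs_div]
    have := div_le_div_of_nonneg_right hr hDpos.le
    linarith
  have T1' : ∀ x, |x - α| < δ₁ → ∃ r, |r| ≤ R ∧ f x = D * ((x - α) *
      (1 + c₂ * (x - α) + c₃ * (x - α) ^ 2 + c₄ * (x - α) ^ 3 + r * (x - α) ^ 4)) := by
    intro x hx
    obtain ⟨r, hr, h⟩ := T1 x hx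
    refine ⟨r / D, hRb r (by linarith), ?_⟩
    simp only [Finset.sum_range_succ, Finset.sum_range_zero, iteratedDeriv_zero, iteratedDeriv_one,
      hroot, i2, i3, i4, ← hD, Nat.factorial] at h
    rw [h]
    field_simp
    push_cast
    ring
  have T2' : ∀ x, |x - α| < δ₂ → ∃ r, |r| ≤ R ∧ deriv f x = D *
      (1 + 2 * c₂ * (x - α) + 3 * c₃ * (x - α) ^ 2 + 4 * c₄ * (x - α) ^ 3 + r * (x - α) ^ 4) := by
    intro x hx
    obtain ⟨r, hr, h⟩ := T2 x hx
    refine ⟨r / D, hRb r (by linarith), ?_⟩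
    simp only [Finset.sum_range_succ, Finset.sum_range_zero, ← iteratedDeriv_succ', Nat.reduceAdd,
      zero_add, iteratedDeriv_one, i2, i3, i4, ← hD, Nat.factorial] at h
    rw [h]
    field_simp
    push_cast
    ring
  have T3' : ∀ x, |x - α| < δ₃ → ∃ r, |r| ≤ R ∧ f x = D *
      ((x - α) + c₂ * (x - α) ^ 2 + r * (x - α) ^ 3) := by
    intro x hx
    obtain ⟨r, hr, h⟩ := T3 x hx
    refine ⟨r / D, hRb r (by linarith), ?_⟩
    simp only [Finset.sum_range_succ, Finset.sum_range_zero, iteratedDeriv_zero, iteratedDeriv_one,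
      hroot, i2, ← hD, Nat.factorial] at h
    rw [h]
    field_simp
    push_cast
    ring
  clear T1 T2 T3
  -- bounds; variables are (e, r, s, p, v)
  obtain ⟨Kb, hKb, Bb⟩ := ns_bound (fun t => 2 * c₂ + 3 * c₃ * t.1 + 4 * c₄ * t.1 ^ 2
    + t.2.2.1 * t.1 ^ 3) (by fun_prop) R
  obtain ⟨Kn, hKn, Bn⟩ := ns_bound (fun t => 2 * c₃ + 3 * c₄ * t.1 + (t.2.2.1 - t.2.1) * t.1 ^ 2
    - c₂ * (2 * c₂ + 3 * c₃ * t.1 + 4 * c₄ * t.1 ^ 2 + t.2.2.1 * t.1 ^ 3)) (by fun_prop) R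
  obtain ⟨S, hS⟩ : ∃ S, S = R + 2 * Kn := ⟨_, rfl⟩
  obtain ⟨Kw, hKw, Bw⟩ := ns_bound (fun t => c₂ + t.1 * t.2.2.2.2) (by fun_prop) S
  obtain ⟨H, hH⟩ : ∃ H : ℝ × ℝ × ℝ × ℝ × ℝ → ℝ, H = fun t =>
    let e := t.1
    let r := t.2.1
    let s := t.2.2.1
    let p := t.2.2.2.1
    let w := c₂ + e * t.2.2.2.2
    let A1 := c₃ + c₄ * e + r * e ^ 2
    let B1 := 3 * c₃ + 4 * c₄ * e + s * e ^ 2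
    let W1 := 2 * c₃ + 3 * c₄ * e + (s - r) * e ^ 2
    let W := c₂ + e * W1
    A1 + B1 + 2 * c₂ ^ 2 + e * (c₂ * B1 + 2 * c₂ * A1) + e ^ 2 * A1 * B1 - W1
      - e * (c₂ * W * w + p * e ^ 2 * W * w ^ 2) := ⟨_, rfl⟩
  have hHc : Continuous H := by rw [hH]; fun_prop
  obtain ⟨KG, hKG, BG⟩ := ns_bound (fun t => 2 * c₂ + t.1 * H t) (by fun_prop) S
  obtain ⟨κ, hκ⟩ : ∃ κ, κ = 3 * c₂ * c₃ - 3 * c₂ ^ 3 := ⟨_, rfl⟩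
  obtain ⟨Q, hQ⟩ : ∃ Q : ℝ × ℝ × ℝ × ℝ × ℝ → ℝ, Q = fun t =>
    let e := t.1
    let r := t.2.1
    let s := t.2.2.1
    let p := t.2.2.2.1
    let v := t.2.2.2.2
    let w := c₂ + e * v
    let A2 := c₄ + r * e
    let W2 := 3 * c₄ + (s - r) * e
    let W1 := 2 * c₃ + 3 * c₄ * e + (s - r) * e ^ 2
    let W := c₂ + e * W1
    c₂ * A2 + 2 * c₃ ^ 2 + 2 * c₃ * e * A2 + W2 * (c₂ + c₃ * e + e ^ 2 * A2)
      - c₂ * (c₂ * v + W1 * w) - p * e * W * w ^ 2 - c₂ ^ 2 * H t - 2 * c₂ * κ - κ * e * H t :=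
    ⟨_, rfl⟩
  have hQc : Continuous Q := by rw [hQ]; fun_prop
  obtain ⟨KQ, hKQ, BQ⟩ := ns_bound Q hQc S
  obtain ⟨δ, hδ, d1, d2, d3, d4, d5, d6⟩ : ∃ δ > (0 : ℝ), δ ≤ 1 ∧ δ ≤ δ₁ ∧ δ ≤ δ₂ ∧
      δ * Kw ≤ δ₃ ∧ δ * Kb ≤ 1 / 2 ∧ δ * KG ≤ 1 / 2 := by
    refine ⟨min 1 (min δ₁ (min δ₂ (min (δ₃ / Kw) (min (1 / 2 / Kb) (1 / 2 / KG))))),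
      by positivity, ?_⟩
    simp only [← le_div_iff₀ hKw, ← le_div_iff₀ hKb, ← le_div_iff₀ hKG]
    simp only [min_le_iff, le_refl, true_or, or_true, and_self]
  refine ⟨δ, hδ, 2 * KQ, by positivity, fun x hx0 hx => ?_⟩
  obtain ⟨r, hr, hfx⟩ := T1' x (hx.trans_le d2)
  obtain ⟨s, hs, hdx⟩ := T2' x (hx.trans_le d3)
  obtain ⟨e, he⟩ : ∃ e, e = x - α := ⟨_, rfl⟩
  rw [← he] at hx0 hx hfx hdx
  have he0 : e ≠ 0 := abs_pos.1 hx0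
  have heR : |e| ≤ R := by linarith
  have hRS : R ≤ S := by linarith
  obtain ⟨A, hA⟩ : ∃ A, A = 1 + c₂ * e + c₃ * e ^ 2 + c₄ * e ^ 3 + r * e ^ 4 := ⟨_, rfl⟩
  obtain ⟨B, hB⟩ : ∃ B, B = 1 + 2 * c₂ * e + 3 * c₃ * e ^ 2 + 4 * c₄ * e ^ 3 + s * e ^ 4 := ⟨_, rfl⟩
  rw [← hA] at hfx
  rw [← hB] at hdx
  have hBhalf : 1 / 2 ≤ B := by
    have := ns_half e _ Kb δ hx (Bb e r s 0 0 heR hr hs (by simp; linarith) (by simp; linarith)) d5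
    refine this.trans (le_of_eq ?_)
    rw [hB]; ring
  have hB0 : B ≠ 0 := by linarith
  obtain ⟨v, hv⟩ : ∃ v, v = (2 * c₃ + 3 * c₄ * e + (s - r) * e ^ 2
    - c₂ * (2 * c₂ + 3 * c₃ * e + 4 * c₄ * e ^ 2 + s * e ^ 3)) / B := ⟨_, rfl⟩
  have hvS : |v| ≤ S := by
    have h1 := Bn e r s 0 0 heR hr hs (by simp; linarith) (by simp; linarith)
    rw [hv, abs_div, abs_of_pos (by linarith : 0 < B), div_le_iff₀ (by linarith)]
    refine h1.trans ?_
    rw [hS]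
    nlinarith
  have hBv : B * v = 2 * c₃ + 3 * c₄ * e + (s - r) * e ^ 2
    - c₂ * (2 * c₂ + 3 * c₃ * e + 4 * c₄ * e ^ 2 + s * e ^ 3) := by rw [hv]; field_simp
  obtain ⟨w, hw⟩ : ∃ w, w = c₂ + e * v := ⟨_, rfl⟩
  obtain ⟨W, hW⟩ : ∃ W, W = c₂ + e * (2 * c₃ + 3 * c₄ * e + (s - r) * e ^ 2) := ⟨_, rfl⟩
  have hBw : B * w = W := by
    rw [hw, mul_add, mul_left_comm, hBv, hW, hB]; ring
  have hBA : B - A = e * W := by rw [hA, hB, hW]; ring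
  have hwK : |w| ≤ Kw := by
    rw [hw]
    exact Bw e 0 0 0 v (by linarith) (by simp; linarith) (by simp; linarith) (by simp; linarith) hvS
  have hdx0 : deriv f x ≠ 0 := by rw [hdx]; exact mul_ne_zero hder hB0
  refine ⟨hdx0, ?_⟩
  intro y
  have hy : y - α = e ^ 2 * w := by
    have : y - α = e - e * A / B := by
      simp only [y]
      rw [hfx, hdx, he]
      field_simp
      ring
    rw [this]
    field_simp
    linear_combination hBA - e * hBw
  have hyδ : |y - α| < δ₃ := by
    rw [hy, abs_mul, abs_pow]
    have h1 : |e| ^ 2 ≤ |e| := by nlinarith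
    calc |e| ^ 2 * |w| ≤ |e| * Kw := mul_le_mul h1 hwK (abs_nonneg _) (abs_nonneg _)
      _ < δ * Kw := by gcongr
      _ ≤ δ₃ := d4
  obtain ⟨p, hp, hfy⟩ := T3' y hyδ
  rw [hy] at hfy
  obtain ⟨C, hC⟩ : ∃ C, C = A - e * w - c₂ * e ^ 3 * w ^ 2 - p * e ^ 5 * w ^ 3 := ⟨_, rfl⟩
  have hfxy : f x - f y = D * (e * C) := by rw [hfx, hfy, hC]; ring
  have hBC : B * C = 1 + e * (2 * c₂ + e * H (e, r, s, p, v)) := by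
    have h1 : B * C = A * B - e * W - c₂ * e ^ 3 * W * w - p * e ^ 5 * W * w ^ 2 := by
      rw [← hBw, hC]; ring
    rw [h1, hH]
    simp only
    rw [← hw, ← hW]
    rw [hA, hB]
    have : W = c₂ + e * (2 * c₃ + 3 * c₄ * e + (s - r) * e ^ 2) := hW
    linear_combination (-e) * this
  have hBChalf : 1 / 2 ≤ B * C := by
    rw [hBC]
    exact ns_half e _ KG δ hx (BG e r s p v (by linarith) (by linarith) (by linarith)
      (by linarith) hvS) d6
  have hBC0 : B * C ≠ 0 := by linarith
  have hC0 : C ≠ 0 := right_ne_zero_of_mul hBC0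
  have hE : B * C - A ^ 2 - (c₂ ^ 2 * e ^ 2 + κ * e ^ 3) * (B * C) = e ^ 4 * Q (e, r, s, p, v) := by
    have h1 : B * C - A ^ 2 = e * W * (A - 1) - c₂ * e ^ 3 * W * w - p * e ^ 5 * W * w ^ 2 := by
      rw [← hBw, hC]
      linear_combination A * hBA - A * e * hBw
    rw [h1, hBC, hQ]
    simp only
    rw [← hw, ← hW]
    generalize H (e, r, s, p, v) = h
    rw [hA, hκ, hW, hw]
    ring
  refine ⟨mul_ne_zero hdx0 (by rw [hfxy]; exact mul_ne_zero hder (mul_ne_zero he0 hC0)), ?_⟩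
  rw [← hκ, ← he]
  have key : x - f x ^ 2 / (deriv f x * (f x - f y)) - α - c₂ ^ 2 * e ^ 3 - κ * e ^ 4
      = e ^ 5 * Q (e, r, s, p, v) / (B * C) := by
    have h1 : f x ^ 2 / (deriv f x * (f x - f y)) = e * A ^ 2 / (B * C) := by
      rw [hfxy, hfx, hdx]
      field_simp
    rw [h1, eq_div_iff hBC0]
    have h2 : e * A ^ 2 / (B * C) * (B * C) = e * A ^ 2 := div_mul_cancel₀ _ hBC0
    linear_combination e * hE - h2 - (B * C) * he
  rw [key, abs_div, abs_mul, abs_pow, abs_of_pos (by linarith : 0 < B * C),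
    div_le_iff₀ (by linarith)]
  have hq := BQ e r s p v (by linarith) (by linarith) (by linarith) (by linarith) hvS
  have h5 : 0 ≤ |e| ^ 5 := by positivity
  calc |e| ^ 5 * |Q (e, r, s, p, v)| ≤ |e| ^ 5 * KQ := by gcongr
    _ = 2 * KQ * |e| ^ 5 * (1 / 2) := by ring
    _ ≤ 2 * KQ * |e| ^ 5 * (B * C) := by gcongr
end

section
/- (Newton–Steffensen method has third order.) Let f : ℝ → ℝ be four times continuously differentiable on an open interval I, and let α ∈ I be a simple root of f (i.e. f(α) = 0 and f'(α) ≠ 0). Then there exist δ > 0 and K > 0 such that for every x with 0 < |x − α| < δ, the quantities y = x − f(x)/f'(x) and z = x − f(x)²/(f'(x)·(f(x) − f(y))) are well defined (denominators nonzero) and satisfy |z − α| ≤ K·|x − α|³. -/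
lemma ns_bounds (f : ℝ → ℝ) (I : Set ℝ) (hI : IsOpen I) (α : ℝ) (hαI : α ∈ I)
    (hf : ContDiffOn ℝ 4 f I) (hroot : f α = 0) :
    ∃ r M : ℝ, 0 < r ∧ 0 < M ∧ ∀ x : ℝ, |x - α| < r →
      |deriv f x - deriv f α| ≤ M * |x - α| ∧
      |f x - deriv f α * (x - α)| ≤ M * |x - α| ^ 2 := by
  have hd : DifferentiableAt ℝ (deriv f) α := by
    have h1 : ContDiffOn ℝ 1 (deriv f) I := hf.deriv_of_isOpen hI (by norm_num)
    exact (h1.differentiableOn (by norm_num)).differentiableAt (hI.mem_nhds hαI)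
  obtain ⟨M, hM, hB⟩ := hd.isBigO_sub.exists_pos
  have hev := hB.bound
  obtain ⟨r, hr, hball⟩ := Metric.eventually_nhds_iff.mp (hev.and (hI.mem_nhds hαI))
  have hb1 : ∀ x : ℝ, |x - α| < r → |deriv f x - deriv f α| ≤ M * |x - α| := by
    intro x hx
    exact (hball (y := x) (by rwa [Real.dist_eq])).1
  refine ⟨r, M, hr, hM, fun x hx => ⟨hb1 x hx, ?_⟩⟩
  have hder : ∀ t ∈ Metric.closedBall α |x - α|,
      HasDerivWithinAt (fun t => f t - deriv f α * (t - α)) (deriv f t - deriv f α)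
        (Metric.closedBall α |x - α|) t := by
    intro t ht
    have ht' : dist t α < r := lt_of_le_of_lt ht hx
    have hfd : DifferentiableAt ℝ f t :=
      (hf.differentiableOn (by norm_num)).differentiableAt (hI.mem_nhds (hball ht').2)
    have h2 := hfd.hasDerivAt.sub (((hasDerivAt_id t).sub_const α).const_mul (deriv f α))
    simp only [mul_one] at h2
    exact h2.hasDerivWithinAt
  have hbd : ∀ t ∈ Metric.closedBall α |x - α|, ‖deriv f t - deriv f α‖ ≤ M * |x - α| := by
    intro t ht
    have ht2 : |t - α| ≤ |x - α| := by simpa [Real.dist_eq] using ht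
    exact (hb1 t (lt_of_le_of_lt ht2 hx)).trans (by gcongr)
  have := (convex_closedBall α |x - α|).norm_image_sub_le_of_norm_hasDerivWithin_le hder hbd
    (Metric.mem_closedBall_self (abs_nonneg _)) (y := x) (by simp [Real.dist_eq])
  simp only [hroot, sub_self, mul_zero, sub_zero, Real.norm_eq_abs] at this
  linarith

/-- The Newton–Steffensen method (3.15) has third order of convergence: if `f` is four
times continuously differentiable on an open interval `I` and `α ∈ I` is a simple root,
then there are `δ > 0` and `K > 0` such that for all `x` with `0 < |x - α| < δ`, the
steps `y = x - f(x)/f'(x)` and `z = x - f(x)²/(f'(x)(f(x) - f(y)))` are well defined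
and `|z - α| ≤ K |x - α|³`. -/
theorem newton_steffensen_third_order
    (f : ℝ → ℝ) (I : Set ℝ) (hI : IsOpen I) (α : ℝ) (hαI : α ∈ I)
    (hf : ContDiffOn ℝ 4 f I) (hroot : f α = 0) (hder : deriv f α ≠ 0) :
    ∃ δ > (0 : ℝ), ∃ K > (0 : ℝ), ∀ x : ℝ, 0 < |x - α| → |x - α| < δ →
      deriv f x ≠ 0 ∧
      (let y := x - f x / deriv f x
       deriv f x * (f x - f y) ≠ 0 ∧
       |x - (f x) ^ 2 / (deriv f x * (f x - f y)) - α| ≤ K * |x - α| ^ 3) := by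
  set c := deriv f α with hc
  obtain ⟨r, M, hr, hM, H⟩ := ns_bounds f I hI α hαI hf hroot
  have hC : 0 < |c| := abs_pos.mpr hder
  refine ⟨min r (|c| / (8 * M)), by positivity, 48 * M ^ 2 / |c| ^ 2, by positivity, ?_⟩
  intro x hx0 hxd
  have hxr : |x - α| < r := lt_of_lt_of_le hxd (min_le_left _ _)
  have hxM : M * |x - α| ≤ |c| / 8 := by
    have h1 : |x - α| < |c| / (8 * M) := lt_of_lt_of_le hxd (min_le_right _ _)
    rw [lt_div_iff₀ (by positivity)] at h1
    linarith
  obtain ⟨hD, hF⟩ := H x hxr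
  rw [← hc] at hD hF
  generalize hDD : deriv f x = D at *
  generalize hFF : f x = F at *
  generalize hE : |x - α| = E at *
  have hDlow : |c| / 2 ≤ |D| := by
    have := abs_sub_abs_le_abs_sub c D
    rw [abs_sub_comm] at this
    linarith
  have hDup : |D| ≤ 2 * |c| := by
    have := abs_sub_abs_le_abs_sub D c
    linarith
  have hDpos : 0 < |D| := by linarith
  have hD0 : D ≠ 0 := abs_pos.mp hDpos
  have hG : |D * (x - α) - F| ≤ 2 * M * E ^ 2 := by
    have e1 : D * (x - α) - F = (D - c) * (x - α) - (F - c * (x - α)) := by ring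
    have h1 := abs_sub ((D - c) * (x - α)) (F - c * (x - α))
    rw [← e1, abs_mul, hE] at h1
    have h2 : |D - c| * E ≤ M * E * E := by gcongr
    linarith
  refine ⟨hD0, ?_⟩
  intro y
  have hy : D * (y - α) = D * (x - α) - F := by
    simp only [y]; field_simp; ring
  have hyb : |y - α| ≤ 4 * M * E ^ 2 / |c| := by
    have h1 : |D| * |y - α| ≤ 2 * M * E ^ 2 := by rw [← abs_mul, hy]; exact hG
    have h2 : |c| / 2 * |y - α| ≤ |D| * |y - α| := by gcongr
    rw [le_div_iff₀ hC]; linarith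
  have hyh : |y - α| ≤ E / 2 := by
    refine hyb.trans ?_
    rw [div_le_iff₀ hC]
    nlinarith
  have hFy := (H y (by linarith)).2
  generalize f y = G at *
  have hY0 := abs_nonneg (y - α)
  generalize hY : |y - α| = Y at *
  have hGY : |G| ≤ |c| * Y + M * Y ^ 2 := by
    have h1 := abs_sub_abs_le_abs_sub G (c * (y - α))
    rw [abs_mul, hY] at h1
    linarith
  have hFlow : |c| * E - M * E ^ 2 ≤ |F| := by
    have h1 := abs_sub_abs_le_abs_sub (c * (x - α)) F
    rw [abs_sub_comm, abs_mul, hE] at h1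
    linarith
  have hden : |c| * E / 4 ≤ |F - G| := by
    have h1 := abs_sub_abs_le_abs_sub F G
    have h2 : M * Y ^ 2 ≤ M * (E / 2) ^ 2 := by gcongr
    have h3 : |c| * Y ≤ |c| * (E / 2) := by gcongr
    have h4 : M * E * E ≤ |c| / 8 * E := by gcongr
    nlinarith
  have hdenD : |c| ^ 2 * E / 8 ≤ |D * (F - G)| := by
    rw [abs_mul]
    have : |c| / 2 * (|c| * E / 4) ≤ |D| * |F - G| := by gcongr
    linarith
  have hpos : 0 < |D * (F - G)| := lt_of_lt_of_le (by positivity) hdenD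
  have hne : D * (F - G) ≠ 0 := abs_pos.mp hpos
  refine ⟨hne, ?_⟩
  have hz : x - F ^ 2 / (D * (F - G)) - α
      = ((F - c * (x - α)) * (D * (x - α) - F)
          - (x - α) * D * (G - c * (y - α))) / (D * (F - G)) := by
    rw [eq_div_iff hne]
    have : (x - F ^ 2 / (D * (F - G)) - α) * (D * (F - G))
        = (x - α) * (D * (F - G)) - F ^ 2 := by
      rw [show x - F ^ 2 / (D * (F - G)) - α = (x - α) - F ^ 2 / (D * (F - G)) by ring,
        sub_mul, div_mul_cancel₀ _ hne]
    rw [this]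
    linear_combination (-(c * (x - α))) * hy
  rw [hz, abs_div, div_le_iff₀ hpos]
  have hnum : |(F - c * (x - α)) * (D * (x - α) - F) - (x - α) * D * (G - c * (y - α))|
      ≤ 6 * M ^ 2 * E ^ 4 := by
    refine (abs_sub _ _).trans ?_
    rw [abs_mul, abs_mul, abs_mul, hE]
    have h1 : |F - c * (x - α)| * |D * (x - α) - F| ≤ (M * E ^ 2) * (2 * M * E ^ 2) := by
      gcongr
    have h2 : E * |D| * |G - c * (y - α)| ≤ E * (2 * |c|) * (M * (4 * M * E ^ 2 / |c|) ^ 2) := by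
      gcongr
      exact hFy.trans (by gcongr)
    have h3 : E * (2 * |c|) * (M * (4 * M * E ^ 2 / |c|) ^ 2)
        = 32 * M ^ 2 * E ^ 4 * (M * E) / |c| := by
      field_simp; ring
    have h4 : 32 * M ^ 2 * E ^ 4 * (M * E) / |c| ≤ 4 * M ^ 2 * E ^ 4 := by
      rw [div_le_iff₀ hC]
      have : 32 * M ^ 2 * E ^ 4 * (M * E) ≤ 32 * M ^ 2 * E ^ 4 * (|c| / 8) := by gcongr
      linarith
    linarith
  refine hnum.trans ?_
  have h5 : 48 * M ^ 2 / |c| ^ 2 * E ^ 3 * (|c| ^ 2 * E / 8)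
      ≤ 48 * M ^ 2 / |c| ^ 2 * E ^ 3 * |D * (F - G)| := by gcongr
  refine le_trans (le_of_eq ?_) h5
  field_simp
  ring
end

section
/- Let N : ℝ → ℝ be Lipschitz with constant L < 1 (a contraction), and let c ∈ ℝ. Define the sequence (x_i) by the Gejji–Jafari recurrence: x₀ = c, x₁ = N(x₀), and x_{m+1} = N(x₀ + ⋯ + x_m) − N(x₀ + ⋯ + x_{m−1}) for m ≥ 1. Then the series ∑_{i=0}^{∞} x_i converges absolutely, and its sum s is the unique real number satisfying s = c + N(s). -/
/-- If `N` is a contraction with Lipschitz constant `L < 1`, the series `∑ xᵢ` produced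
by the Gejji–Jafari recurrence converges absolutely and its sum `s` is the unique real
number satisfying `s = c + N(s)`. -/
theorem gejji_jafari_series_converges
    (N : ℝ → ℝ) (L : ℝ) (hL0 : 0 ≤ L) (hL1 : L < 1)
    (hLip : ∀ u v : ℝ, |N u - N v| ≤ L * |u - v|)
    (c : ℝ) (x : ℕ → ℝ)
    (h0 : x 0 = c)
    (h1 : x 1 = N (x 0))
    (hrec : ∀ m : ℕ, 1 ≤ m →
      x (m + 1) = N (∑ j ∈ Finset.range (m + 1), x j) - N (∑ j ∈ Finset.range m, x j)) :
    Summable (fun i => |x i|) ∧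
    (∑' i, x i) = c + N (∑' i, x i) ∧
    ∀ s : ℝ, s = c + N s → s = ∑' i, x i := by
  have hb : ∀ m : ℕ, |x (m + 1)| ≤ |x 1| * L ^ m := by
    intro m
    induction m with
    | zero => simp
    | succ k ih =>
      rw [hrec (k + 1) (by omega)]
      refine (hLip _ _).trans ?_
      rw [Finset.sum_range_succ _ (k + 1), add_sub_cancel_left]
      calc L * |x (k + 1)| ≤ L * (|x 1| * L ^ k) := mul_le_mul_of_nonneg_left ih hL0
        _ = |x 1| * L ^ (k + 1) := by ring
  have hsabs : Summable (fun i => |x i|) := by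
    rw [← summable_nat_add_iff 1]
    exact Summable.of_nonneg_of_le (fun _ => abs_nonneg _) hb
      ((summable_geometric_of_lt_one hL0 hL1).mul_left _)
  have hs : Summable x := hsabs.of_abs
  have hS : ∀ m : ℕ, ∑ j ∈ Finset.range (m + 2), x j
      = c + N (∑ j ∈ Finset.range (m + 1), x j) := by
    intro m
    induction m with
    | zero => simp [Finset.sum_range_succ, h1, h0]
    | succ k ih =>
      have e1 := Finset.sum_range_succ x (k + 2)
      have e2 := hrec (k + 1) (by omega)
      change ∑ j ∈ Finset.range (k + 2 + 1), x j = c + N (∑ j ∈ Finset.range (k + 2), x j)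
      change x (k + 2) = N (∑ j ∈ Finset.range (k + 2), x j) - _ at e2
      linarith
  have hcont : Continuous N := by
    refine (LipschitzWith.of_dist_le_mul (K := ⟨L, hL0⟩) ?_).continuous
    intro u v
    rw [Real.dist_eq, Real.dist_eq]
    exact hLip u v
  have ht := hs.hasSum.tendsto_sum_nat
  have hfix : (∑' i, x i) = c + N (∑' i, x i) := by
    have ha := ht.comp (Filter.tendsto_add_atTop_nat 2)
    have hc := ((hcont.tendsto _).comp (ht.comp (Filter.tendsto_add_atTop_nat 1))).const_add c
    refine tendsto_nhds_unique ha (hc.congr ?_)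
    intro m
    exact (hS m).symm
  refine ⟨hsabs, hfix, ?_⟩
  intro s hs'
  have h := hLip s (∑' i, x i)
  have he : N s - N (∑' i, x i) = s - ∑' i, x i := by linarith
  rw [he] at h
  have h2 : |s - ∑' i, x i| = 0 := by
    have := abs_nonneg (s - ∑' i, x i)
    nlinarith
  exact sub_eq_zero.mp (abs_eq_zero.mp h2)
end

section
/- (n-th order of the general multi-step method (3.20).) Fix n ≥ 1, let f : ℝ → ℝ be (n + 2) times continuously differentiable on an open interval I, and let α ∈ I be a simple root of f (i.e. f(α) = 0 and f'(α) ≠ 0). For x near α define recursively a₁ = x − f(x)/f'(x) and, for 1 ≤ k ≤ n − 1, a_{k+1} = x − f(x)^{k+1}/(f'(x)·∏_{i=1}^{k}(f(x) − f(a_i))). Then there exist δ > 0 and K > 0 such that for every x with 0 < |x − α| < δ, all denominators appearing in the definitions of a₁, …, a_n are nonzero and |a_n − α| ≤ K·|x − α|^{n+1}; i.e. the n-step method obtained from the Gejji–Jafari decomposition of the Newton–Steffensen scheme has order of convergence n + 1. -/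
lemma msm_local (f : ℝ → ℝ) (I : Set ℝ) (hI : IsOpen I) (α : ℝ) (hαI : α ∈ I)
    (hf : ContDiffOn ℝ 2 f I) (hder : deriv f α ≠ 0) :
    ∃ r > (0 : ℝ), ∃ L > (0 : ℝ), ∃ m > (0 : ℝ),
      (∀ x, |x - α| < r → DifferentiableAt ℝ f x) ∧
      (∀ x y, |x - α| < r → |y - α| < r → |deriv f x - deriv f y| ≤ L * |x - y|) ∧
      (∀ x, |x - α| < r → m ≤ |deriv f x|) := by
  have h1 : ContDiffOn ℝ 1 (deriv f) I := hf.deriv_of_isOpen hI (by norm_num)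
  have h2 : ContDiffAt ℝ 1 (deriv f) α := h1.contDiffAt (hI.mem_nhds hαI)
  obtain ⟨K, t, ht, hK⟩ := h2.exists_lipschitzOnWith
  have h3 : ∀ᶠ x in nhds α, |deriv f α| / 2 < |deriv f x| := by
    have := h2.continuousAt.abs
    exact this.eventually (lt_mem_nhds (by have := abs_pos.mpr hder; linarith))
  have h4 : ∀ᶠ x in nhds α, x ∈ t ∧ x ∈ I ∧ |deriv f α| / 2 < |deriv f x| :=
    Filter.Eventually.and ht (Filter.Eventually.and (hI.mem_nhds hαI) h3)
  obtain ⟨r, hr, h5⟩ := Metric.eventually_nhds_iff.mp h4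
  simp only [Real.dist_eq] at h5
  refine ⟨r, hr, K + 1, by positivity, |deriv f α| / 2, by positivity, ?_, ?_, ?_⟩
  · intro x hx
    exact (hf.contDiffAt (hI.mem_nhds (h5 hx).2.1)).differentiableAt (by norm_num)
  · intro x y hx hy
    have := hK.dist_le_mul x (h5 hx).1 y (h5 hy).1
    simp only [Real.dist_eq] at this
    nlinarith [abs_nonneg (x - y)]
  · intro x hx
    exact (h5 hx).2.2.le

lemma msm_mvt (ψ ψ' : ℝ → ℝ) (C : ℝ)
    (h : ∀ s ∈ Set.Icc (0:ℝ) 1, HasDerivAt ψ (ψ' s) s) (hC : ∀ s ∈ Set.Icc (0:ℝ) 1, |ψ' s| ≤ C) :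
    |ψ 1 - ψ 0| ≤ C := by
  have := (convex_Icc (0:ℝ) 1).norm_image_sub_le_of_norm_hasDerivWithin_le
    (fun s hs => (h s hs).hasDerivWithinAt) hC (x := 0) (y := 1) (by simp) (by simp)
  simpa using this

lemma msm_seg (α r x s : ℝ) (hx : |x - α| < r) (hs : s ∈ Set.Icc (0:ℝ) 1) :
    |α + s * (x - α) - α| < r := by
  rw [add_sub_cancel_left, abs_mul, abs_of_nonneg hs.1]
  nlinarith [abs_nonneg (x - α), hs.2]

lemma msm_hd (f : ℝ → ℝ) (α r x s : ℝ) (hd : ∀ x, |x - α| < r → DifferentiableAt ℝ f x)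
    (hx : |x - α| < r) (hs : s ∈ Set.Icc (0:ℝ) 1) :
    HasDerivAt (fun s => f (α + s * (x - α))) (deriv f (α + s * (x - α)) * (x - α)) s := by
  have h1 : HasDerivAt (fun s : ℝ => α + s * (x - α)) (x - α) s := by
    simpa using ((hasDerivAt_id s).mul_const (x - α)).const_add α
  exact (hd _ (msm_seg α r x s hx hs)).hasDerivAt.comp s h1

lemma msm_newton (f : ℝ → ℝ) (α r L x : ℝ) (hroot : f α = 0) (hL : 0 < L)
    (hd : ∀ x, |x - α| < r → DifferentiableAt ℝ f x)
    (hl : ∀ x y, |x - α| < r → |y - α| < r → |deriv f x - deriv f y| ≤ L * |x - y|)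
    (hx : |x - α| < r) :
    |(x - α) * deriv f x - f x| ≤ L * |x - α| ^ 2 := by
  have := msm_mvt (fun s => s * ((x - α) * deriv f x) - f (α + s * (x - α)))
    (fun s => 1 * ((x - α) * deriv f x) - deriv f (α + s * (x - α)) * (x - α)) (L * |x - α| ^ 2)
    (fun s hs => ((hasDerivAt_id s).mul_const _).sub (msm_hd f α r x s hd hx hs)) ?_
  · simpa [hroot] using this
  · intro s hs
    have h1 := hl x _ hx (msm_seg α r x s hx hs)
    have e1 : x - (α + s * (x - α)) = (1 - s) * (x - α) := by ring
    have h2 : |x - (α + s * (x - α))| ≤ |x - α| := by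
      rw [e1, abs_mul, abs_of_nonneg (by linarith [hs.2])]
      nlinarith [abs_nonneg (x - α), hs.1]
    have e2 : 1 * ((x - α) * deriv f x) - deriv f (α + s * (x - α)) * (x - α)
      = (x - α) * (deriv f x - deriv f (α + s * (x - α))) := by ring
    rw [e2, abs_mul]
    calc _ ≤ |x - α| * (L * |x - α|) := by
          gcongr
          exact h1.trans (by gcongr)
      _ = _ := by ring

lemma msm_secant (f : ℝ → ℝ) (α r L x a : ℝ) (hroot : f α = 0) (hL : 0 < L)
    (hd : ∀ x, |x - α| < r → DifferentiableAt ℝ f x)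
    (hl : ∀ x y, |x - α| < r → |y - α| < r → |deriv f x - deriv f y| ≤ L * |x - y|)
    (hx : |x - α| < r) (ha : |a - α| < r) :
    |(a - α) * f x - (x - α) * f a| ≤ L * |x - α| * |a - α| * |x - a| := by
  have := msm_mvt (fun s => (a - α) * f (α + s * (x - α)) - (x - α) * f (α + s * (a - α)))
    (fun s => (a - α) * (deriv f (α + s * (x - α)) * (x - α))
      - (x - α) * (deriv f (α + s * (a - α)) * (a - α))) (L * |x - α| * |a - α| * |x - a|)
    (fun s hs => ((msm_hd f α r x s hd hx hs).const_mul _).sub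
      ((msm_hd f α r a s hd ha hs).const_mul _)) ?_
  · simpa [hroot] using this
  · intro s hs
    have h1 := hl _ _ (msm_seg α r x s hx hs) (msm_seg α r a s ha hs)
    have e1 : (α + s * (x - α)) - (α + s * (a - α)) = s * (x - a) := by ring
    have h2 : |(α + s * (x - α)) - (α + s * (a - α))| ≤ |x - a| := by
      rw [e1, abs_mul, abs_of_nonneg hs.1]
      nlinarith [abs_nonneg (x - a), hs.2]
    have e2 : (a - α) * (deriv f (α + s * (x - α)) * (x - α))
      - (x - α) * (deriv f (α + s * (a - α)) * (a - α))
      = (x - α) * (a - α) * (deriv f (α + s * (x - α)) - deriv f (α + s * (a - α))) := by ring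
    rw [e2, abs_mul, abs_mul]
    calc _ ≤ |x - α| * |a - α| * (L * |x - a|) := by
          gcongr
          exact h1.trans (by gcongr)
      _ = _ := by ring

lemma msm_lower (f : ℝ → ℝ) (α r m x y : ℝ)
    (hd : ∀ x, |x - α| < r → DifferentiableAt ℝ f x)
    (hm : ∀ x, |x - α| < r → m ≤ |deriv f x|)
    (hx : |x - α| < r) (hy : |y - α| < r) :
    m * |x - y| ≤ |f x - f y| := by
  wlog h : x < y generalizing x y
  · rcases (not_lt.mp h).eq_or_lt with h | h
    · simp [h]
    · rw [abs_sub_comm x, abs_sub_comm (f x)]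
      exact this y x hy hx h
  have hb : ∀ t ∈ Set.Icc x y, |t - α| < r := by
    intro t ht
    rw [abs_lt] at *
    constructor <;> linarith [ht.1, ht.2]
  obtain ⟨c, hc, hc'⟩ := exists_deriv_eq_slope f h
    (fun t ht => (hd t (hb t ht)).continuousAt.continuousWithinAt)
    (fun t ht => (hd t (hb t ⟨ht.1.le, ht.2.le⟩)).differentiableWithinAt)
  have h1 := hm c (hb c ⟨hc.1.le, hc.2.le⟩)
  have h2 : f y - f x = deriv f c * (y - x) := by
    rw [hc', div_mul_cancel₀]; linarith
  rw [abs_sub_comm x, abs_sub_comm (f x), h2, abs_mul]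
  gcongr

/-- The general multi-step method (3.20) has order of convergence `n + 1`: for `f`
`(n+2)` times continuously differentiable on an open interval `I` with simple root
`α ∈ I`, define `a₁ = x - f(x)/f'(x)` and
`a_{k+1} = x - f(x)^{k+1}/(f'(x) ∏_{i=1}^{k} (f(x) - f(aᵢ)))` for `1 ≤ k ≤ n - 1`.
Then there are `δ > 0`, `K > 0` such that for `0 < |x - α| < δ` all the denominators
are nonzero and `|a_n - α| ≤ K |x - α|^{n+1}`. -/
theorem multi_step_method_order
    (n : ℕ) (hn : 1 ≤ n)
    (f : ℝ → ℝ) (I : Set ℝ) (hI : IsOpen I) (α : ℝ) (hαI : α ∈ I)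
    (hf : ContDiffOn ℝ (n + 2) f I) (hroot : f α = 0) (hder : deriv f α ≠ 0) :
    ∃ δ > (0 : ℝ), ∃ K > (0 : ℝ), ∀ x : ℝ, 0 < |x - α| → |x - α| < δ →
      ∀ a : ℕ → ℝ,
        a 1 = x - f x / deriv f x →
        (∀ k : ℕ, 1 ≤ k → k ≤ n - 1 →
          a (k + 1) = x - (f x) ^ (k + 1) /
            (deriv f x * ∏ i ∈ Finset.Icc 1 k, (f x - f (a i)))) →
        (deriv f x ≠ 0 ∧
         (∀ k : ℕ, 1 ≤ k → k ≤ n - 1 →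
           deriv f x * ∏ i ∈ Finset.Icc 1 k, (f x - f (a i)) ≠ 0) ∧
         |a n - α| ≤ K * |x - α| ^ (n + 1)) := by
  obtain ⟨r, hr, L, hL, m, hm, hd, hl, hlow⟩ := msm_local f I hI α hαI
    (hf.of_le (by exact le_add_self)) hder
  have hC : 0 < L / m := by positivity
  refine ⟨min r (1 / (2 * (L / m))), by positivity, (L / m) ^ n, by positivity, ?_⟩
  intro x hx0 hxδ a ha1 ha
  have hxr : |x - α| < r := hxδ.trans_le (min_le_left _ _)
  have hsmall : L / m * |x - α| ≤ 1 / 2 := by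
    have h := (hxδ.trans_le (min_le_right _ _)).le
    rw [le_div_iff₀ (by positivity)] at h
    linarith
  generalize hCdef : L / m = C at *
  have hLC : L = C * m := by rw [← hCdef]; field_simp
  have hfx : m ≤ |deriv f x| := hlow x hxr
  have hfx0 : deriv f x ≠ 0 := abs_pos.mp (hm.trans_le hfx)
  have hrec : ∀ j, j < n → a (j + 1) = x - (f x) ^ (j + 1) /
      (deriv f x * ∏ i ∈ Finset.Icc 1 j, (f x - f (a i))) := by
    intro j hj
    rcases Nat.eq_zero_or_pos j with rfl | h
    · simpa using ha1
    · exact ha j h (by omega)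
  have key : ∀ j, j < n → |a (j + 1) - α| ≤ (C * |x - α|) ^ (j + 1) * |x - α| ∧
      ∏ i ∈ Finset.Icc 1 j, (f x - f (a i)) ≠ 0 := by
    intro j
    induction j with
    | zero =>
      intro hj
      refine ⟨?_, by simp⟩
      have h := msm_newton f α r L x hroot hL hd hl hxr
      have e : a 1 - α = ((x - α) * deriv f x - f x) / deriv f x := by
        rw [ha1]; field_simp; ring
      rw [zero_add, e, abs_div, div_le_iff₀ (by positivity)]
      calc _ ≤ _ := h
        _ = (C * |x - α|) ^ 1 * |x - α| * m := by rw [hLC]; ring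
        _ ≤ _ := by gcongr
    | succ j ih =>
      intro hj
      obtain ⟨hb, hP⟩ := ih (by omega)
      have hhalf : |a (j + 1) - α| ≤ |x - α| / 2 := by
        have h1 : (C * |x - α|) ^ (j + 1) ≤ C * |x - α| :=
          pow_le_of_le_one (by positivity) (by linarith) (by omega)
        nlinarith
      have har : |a (j + 1) - α| < r := by linarith
      have hne : x - a (j + 1) ≠ 0 := by
        intro h
        have : a (j + 1) = x := by linarith
        rw [this] at hhalf
        linarith
      have hlo := msm_lower f α r m x (a (j + 1)) hd hlow hxr har
      have hpos : 0 < |x - a (j + 1)| := abs_pos.mpr hne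
      have hD : f x - f (a (j + 1)) ≠ 0 := by
        apply abs_pos.mp
        exact lt_of_lt_of_le (by positivity) hlo
      have hprod : ∏ i ∈ Finset.Icc 1 (j + 1), (f x - f (a i))
          = (∏ i ∈ Finset.Icc 1 j, (f x - f (a i))) * (f x - f (a (j + 1))) :=
        Finset.prod_Icc_succ_top (by omega) _
      refine ⟨?_, by rw [hprod]; exact mul_ne_zero hP hD⟩
      have e0 := hrec j (by omega)
      have e1 := hrec (j + 1) hj
      rw [hprod] at e1
      have e2 : x - a (j + 1) = (f x) ^ (j + 1) /
        (deriv f x * ∏ i ∈ Finset.Icc 1 j, (f x - f (a i))) := by linarith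
      have e3 : a (j + 1 + 1) = x - (x - a (j + 1)) * f x / (f x - f (a (j + 1))) := by
        rw [e1, e2]
        generalize f x - f (a (j + 1)) = D at *
        field_simp
        ring
      have e4 : a (j + 1 + 1) - α = ((a (j + 1) - α) * f x - (x - α) * f (a (j + 1)))
          / (f x - f (a (j + 1))) := by
        rw [e3]; field_simp; ring
      have h := msm_secant f α r L x (a (j + 1)) hroot hL hd hl hxr har
      rw [e4, abs_div, div_le_iff₀ (abs_pos.mpr hD)]
      calc _ ≤ _ := h
        _ = C * |x - α| * |a (j + 1) - α| * (m * |x - a (j + 1)|) := by rw [hLC]; ring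
        _ ≤ C * |x - α| * ((C * |x - α|) ^ (j + 1) * |x - α|) * |f x - f (a (j + 1))| := by
          gcongr
        _ = _ := by ring
  refine ⟨hfx0, fun k hk1 hk => mul_ne_zero hfx0 (key k (by omega)).2, ?_⟩
  obtain ⟨j, rfl⟩ : ∃ j, n = j + 1 := ⟨n - 1, by omega⟩
  refine (key j (by omega)).1.trans (le_of_eq ?_)
  ring
end
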